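/- Let (Σ,σ) be a topologically transitive countable Markov shift and φ : Σ → ℝ a potential with summable variations and Gurevich pressure P(φ) = 0. If χ_per(φ) := sup{(1/n)S_nφ(x) : σ^n x = x, n ∈ ℕ} < 0, then for every q ∈ ℕ there exist C_q ∈ ℝ and λ_q > 0 such that for all n ∈ ℕ, every x ∈ Σ with x_0 ≤ q and x_n ≤ q satisfies S_nφ(x) ≤ C_q − nλ_q. -/

import Mathlib

open Filter Set MeasureTheory Real ENNReal

namespace CMS

/-- Points of the full sequence space over the alphabet `ℕ`. -/
abbrev Pt : Type := ℕ → ℕ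

/-- The (left) shift map `σ`. -/
def shiftMap : Pt → Pt := fun x i => x (i + 1)

/-- `x` is a point of the countable Markov shift `Σ` determined by the
transition matrix `M` (identified with a relation on the alphabet `ℕ`). -/
def isAdmissible (M : ℕ → ℕ → Prop) (x : Pt) : Prop := ∀ i, M (x i) (x (i + 1))

/-- Topological transitivity: for all states `a, b` there is `N` with
`[a] ∩ σ⁻ᴺ [b] ≠ ∅`. -/
def TopTransitive (M : ℕ → ℕ → Prop) : Prop :=
  ∀ a b : ℕ, ∃ (N : ℕ) (x : Pt), isAdmissible M x ∧ x 0 = a ∧ x N = b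

/-- Birkhoff sum `S_n φ`. -/
noncomputable def birkhoff (φ : Pt → ℝ) (n : ℕ) (x : Pt) : ℝ :=
  ∑ i ∈ Finset.range n, φ (shiftMap^[i] x)

/-- `φ` has summable variations: `∑_{k ≥ 2} var_k(φ) < ∞`, expressed via a summable
sequence dominating the `k`-th variations. -/
def SummableVariations (M : ℕ → ℕ → Prop) (φ : Pt → ℝ) : Prop :=
  ∃ V : ℕ → ℝ, Summable V ∧
    ∀ k, 2 ≤ k → ∀ x y : Pt, isAdmissible M x → isAdmissible M y →
      (∀ i < k, x i = y i) → |φ x - φ y| ≤ V k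

/-- `φ` is weakly Hölder continuous: `var_k(φ) ≤ C θ^k` for all `k ≥ 2`. -/
def WeaklyHolder (M : ℕ → ℕ → Prop) (φ : Pt → ℝ) : Prop :=
  ∃ C θ : ℝ, 0 < C ∧ 0 < θ ∧ θ < 1 ∧
    ∀ k, 2 ≤ k → ∀ x y : Pt, isAdmissible M x → isAdmissible M y →
      (∀ i < k, x i = y i) → |φ x - φ y| ≤ C * θ ^ k

/-- Periodic points of period `n` in the 1-cylinder `[a]`. -/
def PerSet (M : ℕ → ℕ → Prop) (a n : ℕ) : Set Pt :=
  {x | isAdmissible M x ∧ shiftMap^[n] x = x ∧ x 0 = a}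

/-- Periodic points of period `n` in `[a]` whose first return time to `[a]` is `n`. -/
def PerStarSet (M : ℕ → ℕ → Prop) (a n : ℕ) : Set Pt :=
  {x | isAdmissible M x ∧ shiftMap^[n] x = x ∧ x 0 = a ∧ ∀ k, 0 < k → k < n → x k ≠ a}

/-- The Gurevich partition function `Z_n(φ, a)`. -/
noncomputable def Zn (M : ℕ → ℕ → Prop) (φ : Pt → ℝ) (a n : ℕ) : ℝ≥0∞ :=
  ∑' x : PerSet M a n, ENNReal.ofReal (Real.exp (birkhoff φ n x.1))

/-- The first-return partition function `Z_n^*(φ, a)`. -/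
noncomputable def ZnStar (M : ℕ → ℕ → Prop) (φ : Pt → ℝ) (a n : ℕ) : ℝ≥0∞ :=
  ∑' x : PerStarSet M a n, ENNReal.ofReal (Real.exp (birkhoff φ n x.1))

/-- The Gurevich pressure at the state `a`:
`P(φ) = limsup_n (1/n) log Z_n(φ, a)`, with values in `EReal`. -/
noncomputable def pressureAt (M : ℕ → ℕ → Prop) (φ : Pt → ℝ) (a : ℕ) : EReal :=
  Filter.limsup (fun n : ℕ => ((n : ℝ)⁻¹ : EReal) * ENNReal.log (Zn M φ a n)) atTop

/-- `limsup_n (1/n) log Z_n^*(φ, a)`, with values in `EReal`. -/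
noncomputable def pressureStarAt (M : ℕ → ℕ → Prop) (φ : Pt → ℝ) (a : ℕ) : EReal :=
  Filter.limsup (fun n : ℕ => ((n : ℝ)⁻¹ : EReal) * ENNReal.log (ZnStar M φ a n)) atTop

/-- Strong positive recurrence of `φ`, relative to the common value `P` of the
Gurevich pressure: for some state `a`, `limsup_n (1/n) log Z_n^*(φ,a) < P(φ)`. -/
def SPR (M : ℕ → ℕ → Prop) (φ : Pt → ℝ) (P : ℝ) : Prop :=
  ∃ a : ℕ, pressureStarAt M φ a < (P : EReal)

/-- The `F`-property: for every state `a` and every `n ≥ 1` there are only finitely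
many periodic points of period `n` in `[a]`. -/
def FProperty (M : ℕ → ℕ → Prop) : Prop :=
  ∀ a n : ℕ, 0 < n → (PerSet M a n).Finite

/-- `χ_per(φ) = sup { (1/n) S_n φ(x) : σ^n x = x, n ∈ ℕ }`, with values in `EReal`. -/
noncomputable def chiPer (M : ℕ → ℕ → Prop) (φ : Pt → ℝ) : EReal :=
  ⨆ p : {p : Pt × ℕ // isAdmissible M p.1 ∧ 0 < p.2 ∧ shiftMap^[p.2] p.1 = p.1},
    ((birkhoff φ p.1.2 p.1.1 / (p.1.2 : ℝ) : ℝ) : EReal)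

/-- `x` lies in a cylinder belonging to `B(n, M', q)`: it is admissible,
`x 0 ≤ q`, `x n ≤ q` and `#{0 ≤ k ≤ n : x k ≤ q} ≤ (n+1)/M'`. -/
def inBSet (M : ℕ → ℕ → Prop) (n M' q : ℕ) (x : Pt) : Prop :=
  isAdmissible M x ∧ x 0 ≤ q ∧ x n ≤ q ∧
    ((((Finset.range (n + 1)).filter (fun k => x k ≤ q)).card : ℝ) ≤ (n + 1 : ℝ) / (M' : ℝ))

/-- `z_{φ,n}(M',q) = sup { (1/n) S_n φ(x) : x ∈ B for some B ∈ B(n,M',q) }`. -/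
noncomputable def zPhi (M : ℕ → ℕ → Prop) (φ : Pt → ℝ) (n M' q : ℕ) : EReal :=
  ⨆ x : {x : Pt // inBSet M n M' q x}, ((birkhoff φ n x.1 / (n : ℝ) : ℝ) : EReal)

/-- The contraction at infinity
`δ_{φ,∞} = lim_{q→∞} lim_{M'→∞} limsup_{n→∞} z_{φ,n}(M',q)`
(the inner limits exist by monotonicity, so they agree with `liminf`s). -/
noncomputable def deltaInf (M : ℕ → ℕ → Prop) (φ : Pt → ℝ) : EReal :=
  liminf (fun q : ℕ => liminf (fun M' : ℕ =>
    limsup (fun n : ℕ => zPhi M φ n M' q) atTop) atTop) atTop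

/-- `z_n(M',q) = #B(n,M',q)`, the number of `(n+1)`-cylinders (i.e. admissible
words realized in `Σ`) in `B(n,M',q)`, counted in `ℝ≥0∞`. -/
noncomputable def zCount (M : ℕ → ℕ → Prop) (n M' q : ℕ) : ℝ≥0∞ :=
  ∑' _w : {w : Fin (n + 1) → ℕ //
      (∃ x : Pt, isAdmissible M x ∧ ∀ i : Fin (n + 1), x (i : ℕ) = w i) ∧
      w 0 ≤ q ∧ w (Fin.last n) ≤ q ∧
      (((Finset.univ.filter (fun i : Fin (n + 1) => w i ≤ q)).card : ℝ) ≤ (n + 1 : ℝ) / (M' : ℝ))},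
    (1 : ℝ≥0∞)

/-- The entropy at infinity
`h_∞ = lim_{q→∞} lim_{M'→∞} limsup_{n→∞} (1/n) log z_n(M',q)`. -/
noncomputable def hInfty (M : ℕ → ℕ → Prop) : EReal :=
  liminf (fun q : ℕ => liminf (fun M' : ℕ =>
    limsup (fun n : ℕ => ((n : ℝ)⁻¹ : EReal) * ENNReal.log (zCount M n M' q)) atTop) atTop) atTop

end CMS

open CMS

namespace CMS

theorem shiftMap_iterate_apply (n : ℕ) (x : Pt) (i : ℕ) :
    shiftMap^[n] x i = x (i + n) := by
  induction n generalizing x with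
  | zero => rfl
  | succ n ih =>
    rw [Function.iterate_succ_apply, ih, shiftMap]
    congr 1

theorem isAdmissible.shiftMap_iterate {M : ℕ → ℕ → Prop} {x : Pt} (hx : isAdmissible M x)
    (n : ℕ) : isAdmissible M (shiftMap^[n] x) := by
  intro i
  simpa only [shiftMap_iterate_apply, add_right_comm] using hx (i + n)

theorem birkhoff_add (φ : Pt → ℝ) (m n : ℕ) (x : Pt) :
    birkhoff φ (m + n) x = birkhoff φ m x + birkhoff φ n (shiftMap^[m] x) := by
  simp only [birkhoff, Finset.sum_range_add, ← Function.iterate_add_apply, add_comm]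

/-- Bounded distortion: Birkhoff sums of length `n` over points sharing their first `n + 1`
coordinates differ by a uniformly bounded amount. -/
theorem SummableVariations.exists_birkhoff_sub_le {M : ℕ → ℕ → Prop} {φ : Pt → ℝ}
    (hφ : SummableVariations M φ) :
    ∃ D : ℝ, 0 ≤ D ∧ ∀ (n : ℕ) (x y : Pt), isAdmissible M x → isAdmissible M y →
      (∀ i ≤ n, x i = y i) → |birkhoff φ n x - birkhoff φ n y| ≤ D := by
  obtain ⟨V, hV, hvar⟩ := hφ
  refine ⟨∑' k, |V k|, tsum_nonneg fun _ => abs_nonneg _, fun n x y hx hy hxy => ?_⟩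
  calc |birkhoff φ n x - birkhoff φ n y|
      ≤ ∑ i ∈ Finset.range n, |φ (shiftMap^[i] x) - φ (shiftMap^[i] y)| := by
        rw [birkhoff, birkhoff, ← Finset.sum_sub_distrib]
        exact Finset.abs_sum_le_sum_abs _ _
    _ ≤ ∑ i ∈ Finset.range n, |V (n + 1 - i)| := by
        refine Finset.sum_le_sum fun i hi => ?_
        rw [Finset.mem_range] at hi
        refine (hvar (n + 1 - i) (by omega) _ _ (hx.shiftMap_iterate i)
          (hy.shiftMap_iterate i) fun j hj => ?_).trans (le_abs_self _)
        rw [shiftMap_iterate_apply, shiftMap_iterate_apply]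
        exact hxy _ (by omega)
    _ = ∑ k ∈ (Finset.range n).image (fun i => n + 1 - i), |V k| := by
        rw [Finset.sum_image]
        intro i hi j hj hij
        simp only [Finset.coe_range, Set.mem_Iio] at hi hj hij
        omega
    _ ≤ ∑' k, |V k| := hV.abs.sum_le_tsum _ fun _ _ => abs_nonneg _

/-- An admissible word of length `p + 1` with equal endpoints extends to a periodic point. -/
theorem exists_periodic_extension {M : ℕ → ℕ → Prop} {p : ℕ} (hp : 0 < p) (w : Pt)
    (hw : ∀ i < p, M (w i) (w (i + 1))) (hclosed : w p = w 0) :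
    ∃ z : Pt, isAdmissible M z ∧ shiftMap^[p] z = z ∧ ∀ i ≤ p, z i = w i := by
  have hle : ∀ i ≤ p, w (i % p) = w i := by
    intro i hi
    rcases hi.lt_or_eq with h | rfl
    · rw [Nat.mod_eq_of_lt h]
    · rw [Nat.mod_self, hclosed]
  refine ⟨fun i => w (i % p), fun i => ?_, ?_, hle⟩
  · have hr := Nat.mod_lt i hp
    have h := hw _ hr
    rw [← hle (i % p + 1) hr] at h
    simpa [Nat.mod_add_mod] using h
  · funext i
    simp [shiftMap_iterate_apply]

/-- Two admissible points joining `a` to `b` and `b` to `a` are shadowed by a periodic point. -/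
theorem exists_periodic_shadowing {M : ℕ → ℕ → Prop} {x y : Pt} {n N : ℕ} (hn : 0 < n)
    (hx : isAdmissible M x) (hy : isAdmissible M y) (hxy : y 0 = x n) (hyx : y N = x 0) :
    ∃ z : Pt, isAdmissible M z ∧ shiftMap^[n + N] z = z ∧ (∀ i ≤ n, z i = x i) ∧
      ∀ j ≤ N, shiftMap^[n] z j = y j := by
  have hw : ∀ j, (if j + n ≤ n then x (j + n) else y (j + n - n)) = y j := by
    intro j
    rcases j.eq_zero_or_pos with rfl | hj
    · simp [hxy]
    · rw [if_neg (by omega), Nat.add_sub_cancel]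
  obtain ⟨z, hz, hper, hzw⟩ := exists_periodic_extension (M := M) (p := n + N) (by omega)
    (fun i => if i ≤ n then x i else y (i - n))
    (fun i _ => by
      rcases lt_or_ge i n with h | h
      · simpa [h.le, Nat.succ_le_of_lt h] using hx i
      · obtain ⟨j, rfl⟩ := Nat.exists_eq_add_of_le' h
        have := hy j
        rw [← hw j, ← hw (j + 1)] at this
        simpa only [add_right_comm] using this)
    (by simpa only [Nat.zero_le, if_true, add_comm N n, hyx] using hw N)
  refine ⟨z, hz, hper, fun i hi => ?_, fun j hj => ?_⟩
  · rw [hzw i (by omega), if_pos hi]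
  · rw [shiftMap_iterate_apply, hzw _ (by omega), hw]

theorem exists_birkhoff_le_of_chiPer_neg {M : ℕ → ℕ → Prop} {φ : Pt → ℝ}
    (h : chiPer M φ < (0 : EReal)) :
    ∃ c : ℝ, 0 < c ∧ ∀ (n : ℕ) (x : Pt), 0 < n → isAdmissible M x → shiftMap^[n] x = x →
      birkhoff φ n x ≤ -(n * c) := by
  obtain ⟨r, hr, hr0⟩ := EReal.lt_iff_exists_real_btwn.mp h
  refine ⟨-r, neg_pos.mpr (by exact_mod_cast hr0), fun n x hn hx hper => ?_⟩
  have hle : ((birkhoff φ n x / (n : ℝ) : ℝ) : EReal) ≤ (r : EReal) :=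
    (le_iSup (fun p : {p : Pt × ℕ // isAdmissible M p.1 ∧ 0 < p.2 ∧ shiftMap^[p.2] p.1 = p.1} =>
      ((birkhoff φ p.1.2 p.1.1 / (p.1.2 : ℝ) : ℝ) : EReal)) ⟨(x, n), hx, hn, hper⟩).trans hr.le
  rw [EReal.coe_le_coe_iff, div_le_iff₀ (by exact_mod_cast hn)] at hle
  linarith

end CMS

/-- Lemma `lem:UCS-CRC`, normalised so that `P(φ) = 0`.
For a topologically transitive countable Markov shift and a potential `φ` with
summable variations and Gurevich pressure `P(φ) = 0`: if
`χ_per(φ) = sup {(1/n) S_n φ(x) : σ^n x = x} < 0`, then for every `q` there are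
`C_q ∈ ℝ` and `λ_q > 0` such that every `x ∈ Σ` with `x 0 ≤ q` and `x n ≤ q`
satisfies `S_n φ(x) ≤ C_q - n λ_q`. -/
theorem UCS_implies_CRC
    (M : ℕ → ℕ → Prop) (φ : Pt → ℝ)
    (htrans : TopTransitive M)
    (hsum : SummableVariations M φ)
    (hP : ∀ a : ℕ, pressureAt M φ a = (0 : EReal))
    (hUCS : chiPer M φ < (0 : EReal)) :
    ∀ q : ℕ, ∃ C lam : ℝ, 0 < lam ∧ ∀ n : ℕ, ∀ x : Pt, isAdmissible M x →
      x 0 ≤ q → x n ≤ q → birkhoff φ n x ≤ C - n * lam := by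
  intro q
  obtain ⟨D, hD, hdist⟩ := hsum.exists_birkhoff_sub_le
  obtain ⟨c, hc, hper⟩ := exists_birkhoff_le_of_chiPer_neg hUCS
  choose N y hy hy0 hyN using htrans
  set R := Finset.range (q + 1)
  set K : ℝ := ∑ p ∈ R ×ˢ R, |birkhoff φ (N p.1 p.2) (y p.1 p.2)|
  have hK0 : 0 ≤ K := Finset.sum_nonneg fun _ _ => abs_nonneg _
  refine ⟨2 * D + K, c, hc, fun n x hx hx0 hxn => ?_⟩
  rcases n.eq_zero_or_pos with rfl | hn
  · simp only [birkhoff, Finset.range_zero, Finset.sum_empty, Nat.cast_zero, zero_mul, sub_zero]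
    positivity
  have hKle : |birkhoff φ (N (x n) (x 0)) (y (x n) (x 0))| ≤ K :=
    Finset.single_le_sum (f := fun p : ℕ × ℕ => |birkhoff φ (N p.1 p.2) (y p.1 p.2)|)
      (fun _ _ => abs_nonneg _) (a := (x n, x 0)) (by simp [R]; omega)
  obtain ⟨z, hz, hzper, hzx, hzy⟩ :=
    exists_periodic_shadowing hn hx (hy (x n) (x 0)) (hy0 _ _) (hyN _ _)
  have h1 := abs_le.mp (hdist n z x hz hx hzx)
  have h2 := abs_le.mp (hdist _ _ _ (hz.shiftMap_iterate n) (hy (x n) (x 0)) hzy)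
  have h3 := hper _ z (by omega) hz hzper
  rw [birkhoff_add] at h3
  push_cast at h3
  have h4 : 0 ≤ (N (x n) (x 0) : ℝ) * c := by positivity
  have h5 := neg_abs_le (birkhoff φ (N (x n) (x 0)) (y (x n) (x 0)))
  linarith [h1.1, h2.1]
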